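/- Let χ̂_s(z) = T (∫_{σ(H)} 2(E₀−λ)/((E₀−λ)²−z²) dP^H_λ) T* with H self-adjoint on ⋀^N L²(ℝ³) satisfying the standing assumptions and T ∈ B(⋀^N L²(ℝ³), 𝓗), 𝓗 a Hilbert space, and let Ω = inf σ_ess(H) − E₀ and P(χ̂_s) its set of poles in D_Ω = ℂ \ ((−∞,−Ω]∪[Ω,∞)). Then: (i) for every z ∈ D_Ω \ P(χ̂_s), χ̂_s(z) = χ̂_s(z̄)* = χ̂_s(−z); in particular χ̂_s(z) is self-adjoint for real z; (ii) for every ω ∈ (−Ω,Ω) \ P(χ̂_s), the essential spectrum of the self-adjoint operator χ̂_s(ω) is contained in (−∞, 0]. -/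

import Mathlib

open MeasureTheory ENNReal NNReal Complex Asymptotics
open scoped InnerProductSpace Topology
noncomputable section

/-! ### Meromorphic families of operators (Definition 2.7) -/

section Merom

variable {E F : Type*} [NormedAddCommGroup E] [NormedSpace ℂ E]
  [NormedAddCommGroup F] [NormedSpace ℂ F]

/-- A finite-rank (bounded) operator. -/
def FiniteRankOp (A : E →L[ℂ] F) : Prop := FiniteDimensional ℂ ↥(LinearMap.range A.toLinearMap)

/-- `K` is a meromorphic family of operators near `z₀`: near `z₀` it equals a holomorphic
family plus finitely many finite-rank principal parts `K₋ⱼ/(z−z₀)ʲ`. -/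
def MeromAt (K : ℂ → (E →L[ℂ] F)) (z₀ : ℂ) : Prop :=
  ∃ (k : ℕ) (c : ℕ → (E →L[ℂ] F)) (K₀ : ℂ → (E →L[ℂ] F)) (U : Set ℂ),
    IsOpen U ∧ z₀ ∈ U ∧ AnalyticOnNhd ℂ K₀ U ∧ (∀ j, FiniteRankOp (c j)) ∧
    ∀ z ∈ U, z ≠ z₀ → K z = K₀ z + ∑ j ∈ Finset.range k, ((z - z₀) ^ (j + 1))⁻¹ • c j

/-- `K` is a meromorphic family of operators on the open set `D`. -/
def MeromOn (K : ℂ → (E →L[ℂ] F)) (D : Set ℂ) : Prop := ∀ z₀ ∈ D, MeromAt K z₀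

/-- `K` has a simple pole at `z₀` with (finite-rank, nonzero) residue `R`. -/
def SimplePoleAt (K : ℂ → (E →L[ℂ] F)) (z₀ : ℂ) (R : E →L[ℂ] F) : Prop :=
  R ≠ 0 ∧ FiniteRankOp R ∧
  ∃ (K₀ : ℂ → (E →L[ℂ] F)) (U : Set ℂ), IsOpen U ∧ z₀ ∈ U ∧ AnalyticOnNhd ℂ K₀ U ∧
    ∀ z ∈ U, z ≠ z₀ → K z = K₀ z + (z - z₀)⁻¹ • R

/-- `K` has a (simple) pole at `z₀`. -/
def IsPoleAt (K : ℂ → (E →L[ℂ] F)) (z₀ : ℂ) : Prop := ∃ R, SimplePoleAt K z₀ R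

open scoped Classical in
/-- The rank of a (simple) pole of `K` at `z₀`: the rank of the residue there
(`0` if there is no simple pole at `z₀`). -/
noncomputable def poleRank (K : ℂ → (E →L[ℂ] F)) (z₀ : ℂ) : ℕ :=
  if h : ∃ R, SimplePoleAt K z₀ R then Module.finrank ℂ ↥(LinearMap.range h.choose.toLinearMap) else 0

end Merom

/-- The domain `D_Ω = ℂ \ ((−∞,−Ω] ∪ [Ω,∞))`. -/
def DOmega (Ω : ℝ) : Set ℂ := {z : ℂ | z.im ≠ 0 ∨ |z.re| < Ω}
/-! ### Self-adjoint Hamiltonians, encoded through their projection-valued spectral measure -/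

open scoped InnerProductSpace

/-- The spectral data of a self-adjoint Hamiltonian `H`: the projection-valued spectral
measure `A ↦ P^H(A)` together with the diagonal spectral measures
`x ↦ μ_x = ⟪x, P^H(·) x⟫ = ‖P^H(·)x‖²`. -/
structure SpectralData (𝓗 : Type*) [NormedAddCommGroup 𝓗] [InnerProductSpace ℂ 𝓗] where
  proj : Set ℝ → (𝓗 →L[ℂ] 𝓗)
  diag : 𝓗 → MeasureTheory.Measure ℝ
  proj_symm : ∀ A : Set ℝ, MeasurableSet A → ∀ x y : 𝓗, ⟪proj A x, y⟫_ℂ = ⟪x, proj A y⟫_ℂ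
  proj_comp : ∀ A B : Set ℝ, MeasurableSet A → MeasurableSet B →
    proj A ∘L proj B = proj (A ∩ B)
  proj_univ : proj Set.univ = ContinuousLinearMap.id ℂ 𝓗
  diag_apply : ∀ (x : 𝓗) (A : Set ℝ), MeasurableSet A →
    diag x A = (‖proj A x‖₊ : ℝ≥0∞) ^ 2

variable {𝓗 : Type*} [NormedAddCommGroup 𝓗] [InnerProductSpace ℂ 𝓗]

/-- The spectrum `σ(H)` (the support of the spectral measure). -/
def SpectralData.spec (P : SpectralData 𝓗) : Set ℝ :=
  {a | ∀ ε > 0, P.proj (Set.Ioo (a - ε) (a + ε)) ≠ 0}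

/-- The essential spectrum `σ_ess(H)` (the points at which every spectral window has
infinite rank). -/
def SpectralData.essSpec (P : SpectralData 𝓗) : Set ℝ :=
  {a | ∀ ε > 0, ¬ FiniteDimensional ℂ ↥(LinearMap.range (P.proj (Set.Ioo (a - ε) (a + ε))).toLinearMap)}

/-- Assumption 1: `E₀` is the ground-state energy of `H`, a simple isolated eigenvalue with
normalized ground state `Ψ₀`. -/
structure IsGroundState (P : SpectralData 𝓗) (E₀ : ℝ) (Ψ₀ : 𝓗) : Prop where
  unit : ‖Ψ₀‖ = 1
  bottom : P.proj (Set.Iio E₀) = 0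
  eig : P.proj {E₀} Ψ₀ = Ψ₀
  simple : LinearMap.range (P.proj {E₀}).toLinearMap = Submodule.span ℂ {Ψ₀}
  isolated : ∃ ε > 0, P.proj (Set.Ioo (E₀ - ε) (E₀ + ε)) = P.proj {E₀}

section Symmetrized

variable {𝓗N 𝓗' : Type*} [NormedAddCommGroup 𝓗N] [InnerProductSpace ℂ 𝓗N]
  [CompleteSpace 𝓗N] [NormedAddCommGroup 𝓗'] [InnerProductSpace ℂ 𝓗'] [CompleteSpace 𝓗']

/-- The set of poles of `χ̂_s` in `D_Ω`: the real `ω ≠ 0` with `|ω| < Ω` and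
`T P^H_{E₀+|ω|} ≠ 0` (Section 4, eq. (4.2)). -/
def chisPoles (P : SpectralData 𝓗N) (E₀ Ω : ℝ) (T : 𝓗N →L[ℂ] 𝓗') : Set ℂ :=
  {z : ℂ | ∃ ω : ℝ, z = (ω : ℂ) ∧ ω ≠ 0 ∧ |ω| < Ω ∧ T ∘L P.proj {E₀ + |ω|} ≠ 0}

/-- `χs` is the symmetrized density-density response function
`χ̂_s(z) = T (∫_{σ(H)} 2(E₀−λ)/((E₀−λ)²−z²) dP^H_λ) T*` of eq. (4.1), characterized (by
polarization) through its quadratic form on `D_Ω` minus the pole set. -/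
def IsSymmetrizedDDRF (P : SpectralData 𝓗N) (E₀ Ω : ℝ) (T : 𝓗N →L[ℂ] 𝓗')
    (χs : ℂ → (𝓗' →L[ℂ] 𝓗')) : Prop :=
  ∀ z ∈ DOmega Ω \ chisPoles P E₀ Ω T, ∀ f : 𝓗',
    Integrable (fun lam : ℝ => (2 * ((E₀ : ℂ) - lam)) / (((E₀ : ℂ) - lam) ^ 2 - z ^ 2))
      (P.diag (T.adjoint f)) ∧
    ⟪f, χs z f⟫_ℂ = ∫ lam : ℝ,
      (2 * ((E₀ : ℂ) - lam)) / (((E₀ : ℂ) - lam) ^ 2 - z ^ 2) ∂(P.diag (T.adjoint f))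

end Symmetrized

/-- The orthogonal projection onto the orthogonal complement of a subspace `V` of a Hilbert
space, as an endomorphism. -/
noncomputable def perpProj {H : Type*} [NormedAddCommGroup H] [InnerProductSpace ℂ H]
    [CompleteSpace H] (V : Submodule ℂ H) : H →L[ℂ] H :=
  haveI : CompleteSpace ↥(Vᗮ) := V.isClosed_orthogonal.completeSpace_coe
  haveI : Submodule.HasOrthogonalProjection (Vᗮ) := Submodule.HasOrthogonalProjection.ofCompleteSpace (K := Vᗮ)
  (Vᗮ).subtypeL ∘L Submodule.orthogonalProjection Vᗮ

/-- The orthogonal projection onto (the closure of) a subspace `V` of a Hilbert space. -/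
noncomputable def projOnto {H : Type*} [NormedAddCommGroup H] [InnerProductSpace ℂ H]
    [CompleteSpace H] (V : Submodule ℂ H) : H →L[ℂ] H :=
  ContinuousLinearMap.id ℂ H - perpProj V

/-- The essential spectrum of a bounded (self-adjoint) operator: its spectrum minus the
isolated eigenvalues of finite multiplicity. -/
def essSpecOp {H : Type*} [NormedAddCommGroup H] [InnerProductSpace ℂ H] [CompleteSpace H]
    (A : H →L[ℂ] H) : Set ℂ :=
  {μ ∈ spectrum ℂ A |
    ¬ ((∃ ε > 0, ∀ μ' ∈ spectrum ℂ A, ‖μ' - μ‖ < ε → μ' = μ) ∧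
       FiniteDimensional ℂ ↥(LinearMap.ker (A - μ • (1 : H →L[ℂ] H)).toLinearMap))}

/-! ### Spectral projections -/

section SpectralProjections

lemma finiteRankOp_zero {E F : Type*} [NormedAddCommGroup E] [NormedSpace ℂ E]
    [NormedAddCommGroup F] [NormedSpace ℂ F] : FiniteRankOp (0 : E →L[ℂ] F) := by
  have h : LinearMap.range (0 : E →L[ℂ] F).toLinearMap = ⊥ := LinearMap.range_zero
  rw [FiniteRankOp, h]
  infer_instance

lemma SpectralData.range_proj_mono (P : SpectralData 𝓗) {A B : Set ℝ} (hA : MeasurableSet A)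
    (hB : MeasurableSet B) (hAB : A ⊆ B) :
    LinearMap.range (P.proj A).toLinearMap ≤ LinearMap.range (P.proj B).toLinearMap := by
  rintro _ ⟨x, rfl⟩
  refine ⟨P.proj A x, ?_⟩
  have h := P.proj_comp B A hB hA
  rw [Set.inter_eq_right.2 hAB] at h
  exact DFunLike.congr_fun h x

lemma SpectralData.diag_eq_zero_iff (P : SpectralData 𝓗) {A : Set ℝ} (hA : MeasurableSet A)
    (x : 𝓗) : P.diag x A = 0 ↔ P.proj A x = 0 := by
  simp [P.diag_apply x A hA]

lemma SpectralData.finiteRankOp_proj_union (P : SpectralData 𝓗) {A B : Set ℝ}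
    (hA : MeasurableSet A) (hB : MeasurableSet B) (hfA : FiniteRankOp (P.proj A))
    (hfB : FiniteRankOp (P.proj B)) : FiniteRankOp (P.proj (A ∪ B)) := by
  unfold FiniteRankOp at *
  let L := ((P.proj A).toLinearMap.rangeRestrict.prod (P.proj B).toLinearMap.rangeRestrict).comp
    (LinearMap.range (P.proj (A ∪ B)).toLinearMap).subtype
  refine FiniteDimensional.of_injective L ?_
  rw [← LinearMap.ker_eq_bot, LinearMap.ker_eq_bot']
  rintro ⟨_, x, rfl⟩ hx
  have h1 : P.proj A (P.proj (A ∪ B) x) = 0 := congrArg (fun y => (y.1 : 𝓗)) hx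
  have h2 : P.proj B (P.proj (A ∪ B) x) = 0 := congrArg (fun y => (y.2 : 𝓗)) hx
  rw [← P.diag_eq_zero_iff hA] at h1
  rw [← P.diag_eq_zero_iff hB] at h2
  have h3 := (P.diag_eq_zero_iff (hA.union hB) _).1 (measure_union_null h1 h2)
  have h4 := DFunLike.congr_fun (P.proj_comp (A ∪ B) (A ∪ B) (hA.union hB) (hA.union hB)) x
  rw [Set.inter_self] at h4
  exact Subtype.ext (h4.symm.trans h3)

/-- A bounded interval lying below the essential spectrum carries only finitely many
eigenvalues, counted with multiplicity. -/
lemma SpectralData.finiteRankOp_proj_of_subset_Icc (P : SpectralData 𝓗) {a b : ℝ} {S : Set ℝ}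
    (hS : MeasurableSet S) (hSab : S ⊆ Set.Icc a b) (h : ∀ x ∈ Set.Icc a b, x ∉ P.essSpec) :
    FiniteRankOp (P.proj S) := by
  have key : ∃ A, MeasurableSet A ∧ Set.Icc a b ⊆ A ∧ FiniteRankOp (P.proj A) := by
    refine isCompact_Icc.induction_on (p := fun s => ∃ A, MeasurableSet A ∧ s ⊆ A ∧
      FiniteRankOp (P.proj A)) ?_ ?_ ?_ ?_
    · refine ⟨∅, MeasurableSet.empty, subset_rfl, ?_⟩
      have h0 : P.proj ∅ = 0 := by
        ext x
        exact (P.diag_eq_zero_iff MeasurableSet.empty x).1 measure_empty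
      rw [h0]
      exact finiteRankOp_zero
    · rintro s t hst ⟨A, hA, htA, hf⟩
      exact ⟨A, hA, hst.trans htA, hf⟩
    · rintro s t ⟨A, hA, hsA, hfA⟩ ⟨B, hB, htB, hfB⟩
      exact ⟨A ∪ B, hA.union hB, Set.union_subset_union hsA htB,
        P.finiteRankOp_proj_union hA hB hfA hfB⟩
    · intro x hx
      have hx' := h x hx
      simp only [SpectralData.essSpec, Set.mem_ofPred_eq, not_forall, not_not] at hx'
      obtain ⟨ε, hε, hf⟩ := hx'
      exact ⟨_, mem_nhdsWithin_of_mem_nhds (Ioo_mem_nhds (by linarith) (by linarith)),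
        _, measurableSet_Ioo, subset_rfl, hf⟩
  obtain ⟨A, hA, hsub, hf⟩ := key
  unfold FiniteRankOp at *
  exact Submodule.finiteDimensional_of_le (P.range_proj_mono hS hA (hSab.trans hsub))

lemma SpectralData.proj_eq_zero_of_subset (P : SpectralData 𝓗) {A B : Set ℝ}
    (hA : MeasurableSet A) (hB : MeasurableSet B) (hAB : A ⊆ B) (h : P.proj B = 0) :
    P.proj A = 0 := by
  have h' := P.proj_comp B A hB hA
  rw [Set.inter_eq_right.2 hAB, h, ContinuousLinearMap.zero_comp] at h'
  exact h'.symm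

lemma SpectralData.le_of_mem_essSpec (P : SpectralData 𝓗) {E₀ a : ℝ}
    (hbot : P.proj (Set.Iio E₀) = 0) (ha : a ∈ P.essSpec) : E₀ ≤ a := by
  by_contra! hlt
  refine ha (E₀ - a) (by linarith) ?_
  have h0 : P.proj (Set.Ioo (a - (E₀ - a)) (a + (E₀ - a))) = 0 :=
    P.proj_eq_zero_of_subset measurableSet_Ioo measurableSet_Iio
      (fun x hx => by have := hx.2; simp only [Set.mem_Iio]; linarith) hbot
  rw [h0]
  exact finiteRankOp_zero

end SpectralProjections

/-! ### Operators with nonpositive form on a subspace of finite codimension -/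

section FiniteCodimension

open Polynomial

variable {H K : Type*} [NormedAddCommGroup H] [InnerProductSpace ℂ H]
  [NormedAddCommGroup K] [InnerProductSpace ℂ K]

lemma finite_spectrum_of_finiteRankOp {G : H →L[ℂ] H} (hG : FiniteRankOp G) :
    (spectrum ℂ G).Finite := by
  unfold FiniteRankOp at hG
  set V := LinearMap.range G.toLinearMap with hV
  have hmaps : ∀ x ∈ V, G.toLinearMap x ∈ V := fun x _ => ⟨x, rfl⟩
  let p := minpoly ℂ (G.toLinearMap.restrict hmaps)
  have hp : p ≠ 0 := minpoly.ne_zero (Algebra.IsIntegral.isIntegral _)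
  have hpow : ∀ (q : ℂ[X]) (v : V),
      (aeval G q) (v : H) = ((aeval (G.toLinearMap.restrict hmaps) q) v : V) := by
    intro q
    induction q using Polynomial.induction_on' with
    | add q r hq hr => intro v; simp [hq, hr]
    | monomial n a =>
      intro v
      have : ∀ n : ℕ, ∀ v : V,
          (G ^ n) (v : H) = (((G.toLinearMap.restrict hmaps) ^ n) v : V) := by
        intro n
        induction n with
        | zero => intro v; simp
        | succ n ih =>
          intro v
          have := ih (G.toLinearMap.restrict hmaps v)
          rw [pow_succ, pow_succ]
          exact this
      simp [aeval_monomial, Algebra.algebraMap_eq_smul_one, this]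
  have hzero : aeval G (p * X) = 0 := by
    ext x
    have h1 := hpow p ⟨G x, x, rfl⟩
    rw [minpoly.aeval] at h1
    simpa using h1
  refine ((p * X).roots.toFinset.finite_toSet).subset fun z hz => ?_
  have h1 := spectrum.subset_polynomial_aeval G (p * X) ⟨z, hz, rfl⟩
  rw [hzero] at h1
  have : Nontrivial (H →L[ℂ] H) := by
    by_contra hn
    rw [not_nontrivial_iff_subsingleton] at hn
    rw [spectrum.of_subsingleton] at hz
    exact hz
  rw [spectrum.zero_eq] at h1
  simp only [Finset.mem_coe, Multiset.mem_toFinset, mem_roots (mul_ne_zero hp X_ne_zero)]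
  exact h1

lemma finiteDimensional_of_disjoint_ker {B : H →L[ℂ] K} (hB : FiniteRankOp B)
    {V : Submodule ℂ H} (h : ∀ v ∈ V, B v = 0 → v = 0) : FiniteDimensional ℂ V := by
  unfold FiniteRankOp at hB
  refine FiniteDimensional.of_injective (B.toLinearMap.rangeRestrict.comp V.subtype) ?_
  rw [← LinearMap.ker_eq_bot, LinearMap.ker_eq_bot']
  rintro ⟨v, hv⟩ hv0
  exact Subtype.ext (h v hv (congrArg (fun y => y.1) hv0))

variable [CompleteSpace H]

lemma finite_spectrum_inter_Ioi {A : H →L[ℂ] H} (hA : IsSelfAdjoint A) {B : H →L[ℂ] K}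
    (hB : FiniteRankOp B) (hneg : ∀ f, B f = 0 → (⟪f, A f⟫_ℂ).re ≤ 0) {c : ℝ} (hc : 0 < c) :
    (spectrum ℝ A ∩ Set.Ioi c).Finite := by
  set g : ℝ → ℝ := fun x => max (x - c) 0 with hg
  have hgc : Continuous g := by fun_prop
  set G := cfc g A with hGdef
  have hGsa : IsSelfAdjoint G := cfc_predicate g A
  have hpos : (0 : H →L[ℂ] H) ≤ G * A * G - c • (G * G) := by
    have : G * A * G - c • (G * G) = cfc (fun x => g x * x * g x - c • (g x * g x)) A := by
      rw [cfc_sub (fun x => g x * x * g x) (fun x => c • (g x * g x)) A,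
        cfc_smul c (fun x => g x * g x) A, cfc_mul (fun x => g x * x) g A,
        cfc_mul g (fun x => x) A, cfc_mul g g A, cfc_id' ℝ A]
    rw [this]
    refine cfc_nonneg fun x _ => ?_
    simp only [hg, smul_eq_mul]
    rcases le_total (x - c) 0 with h | h
    · rw [max_eq_right h]; simp
    · rw [max_eq_left h]
      have : 0 ≤ (x - c) * (x - c) ^ 2 := by positivity
      nlinarith
  have hrange : FiniteRankOp G := by
    refine finiteDimensional_of_disjoint_ker hB ?_
    rintro _ ⟨h, rfl⟩ hB0
    have h1 := hneg _ hB0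
    have h2 := ((ContinuousLinearMap.nonneg_iff_isPositive _).1 hpos).re_inner_nonneg_right h
    have hadj : ∀ x y : H, ⟪x, G y⟫_ℂ = ⟪G x, y⟫_ℂ := fun x y =>
      (hGsa.isSymmetric x y).symm
    have h3 : RCLike.re ⟪h, (G * A * G - c • (G * G)) h⟫_ℂ
        = (⟪G h, A (G h)⟫_ℂ).re - c * ‖G h‖ ^ 2 := by
      rw [sub_apply, inner_sub_right, map_sub]
      congr 1
      · simp [hadj]
      · have : (c • (G * G)) h = (c : ℂ) • G (G h) := by
          simp
        rw [this, inner_smul_right, hadj, inner_self_eq_norm_sq_to_K]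
        exact (Complex.re_ofReal_mul _ _).trans (by norm_cast)
    rw [h3] at h2
    have h4 : ‖G h‖ ^ 2 ≤ 0 := by
      by_contra! h5
      have := mul_pos hc h5
      have h1' : (⟪G h, A (G h)⟫_ℂ).re ≤ 0 := h1
      linarith
    have : ‖G h‖ = 0 := by nlinarith [norm_nonneg (G h)]
    exact norm_eq_zero.1 this
  have hfin : (spectrum ℝ G).Finite := by
    have := (finite_spectrum_of_finiteRankOp hrange).preimage
      (f := algebraMap ℝ ℂ) (algebraMap ℝ ℂ).injective.injOn
    rwa [spectrum.preimage_algebraMap] at this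
  have hmap : spectrum ℝ G = g '' spectrum ℝ A := cfc_map_spectrum g A
  rw [hmap] at hfin
  refine Set.Finite.of_finite_image (f := g)
    (hfin.subset (Set.image_mono Set.inter_subset_left)) ?_
  rintro x ⟨-, hx⟩ y ⟨-, hy⟩ hxy
  simp only [Set.mem_Ioi] at hx hy
  simp only [hg] at hxy
  rw [max_eq_left (by linarith), max_eq_left (by linarith)] at hxy
  linarith

lemma essSpecOp_nonpos_of_finiteRankOp {A : H →L[ℂ] H} (hA : IsSelfAdjoint A) {B : H →L[ℂ] K}
    (hB : FiniteRankOp B) (hneg : ∀ f, B f = 0 → (⟪f, A f⟫_ℂ).re ≤ 0) {μ : ℂ}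
    (hμ : μ ∈ essSpecOp A) : μ.im = 0 ∧ μ.re ≤ 0 := by
  obtain ⟨hμs, hμn⟩ := hμ
  have hreal : ∀ ν ∈ spectrum ℂ A, ν = ((ν.re : ℝ) : ℂ) := fun ν hν =>
    hA.mem_spectrum_eq_re hν
  have hμre := hreal μ hμs
  refine ⟨by rw [hμre]; simp, ?_⟩
  by_contra! hpos
  refine hμn ⟨?_, ?_⟩
  · have hfin := finite_spectrum_inter_Ioi hA hB hneg (half_pos hpos)
    have hfin' : ((spectrum ℝ A ∩ Set.Ioi (μ.re / 2)) \ {μ.re}).Finite := hfin.sdiff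
    obtain ⟨ε, hε, hball⟩ := Metric.isOpen_iff.1 hfin'.isClosed.isOpen_compl μ.re (by simp)
    refine ⟨min ε (μ.re / 2), lt_min hε (half_pos hpos), fun ν hν hνμ => ?_⟩
    have hν' := hreal ν hν
    by_contra hne
    have hdist : |ν.re - μ.re| < min ε (μ.re / 2) :=
      (Complex.abs_re_le_norm (ν - μ)).trans_lt hνμ
    have h1 := (abs_lt.1 (hdist.trans_le (min_le_right _ _))).1
    refine hball (a := ν.re) (by
      rw [Metric.mem_ball, Real.dist_eq]; exact hdist.trans_le (min_le_left _ _)) ⟨⟨?_, ?_⟩, ?_⟩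
    · rw [← spectrum.preimage_algebraMap (S := ℂ), Set.mem_preimage]
      rw [hν'] at hν
      exact hν
    · simp only [Set.mem_Ioi]; linarith
    · intro h
      rw [Set.mem_singleton_iff] at h
      exact hne (by rw [hν', hμre, h])
  · refine finiteDimensional_of_disjoint_ker hB fun v hv hBv => ?_
    have hv' : A v = μ • v := by
      have : A v - μ • v = 0 := hv
      exact sub_eq_zero.1 this
    have h1 := hneg v hBv
    rw [hv', inner_smul_right, inner_self_eq_norm_sq_to_K, hμre] at h1
    have h2 : μ.re * ‖v‖ ^ 2 ≤ 0 := by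
      have h3 : ((μ.re : ℂ) * ((‖v‖ : ℝ) : ℂ) ^ 2).re = μ.re * ‖v‖ ^ 2 := by norm_cast
      exact h3 ▸ h1
    by_contra hne
    have := mul_pos hpos (pow_pos (norm_pos_iff.2 hne) 2)
    linarith

end FiniteCodimension

/-! ### The symmetrized response function -/

section Response

variable {𝓗N 𝓗' : Type*} [NormedAddCommGroup 𝓗N] [InnerProductSpace ℂ 𝓗N]
  [NormedAddCommGroup 𝓗'] [InnerProductSpace ℂ 𝓗']

lemma conj_mem_DOmega_diff_chisPoles {P : SpectralData 𝓗N} {E₀ Ω : ℝ} {T : 𝓗N →L[ℂ] 𝓗'} {z : ℂ}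
    (hz : z ∈ DOmega Ω \ chisPoles P E₀ Ω T) :
    (starRingEnd ℂ) z ∈ DOmega Ω \ chisPoles P E₀ Ω T := by
  refine ⟨by simpa [DOmega] using hz.1, ?_⟩
  rintro ⟨ω, h, hω⟩
  exact hz.2 ⟨ω, by rw [← Complex.conj_conj z, h, Complex.conj_ofReal], hω⟩

lemma neg_mem_DOmega_diff_chisPoles {P : SpectralData 𝓗N} {E₀ Ω : ℝ} {T : 𝓗N →L[ℂ] 𝓗'} {z : ℂ}
    (hz : z ∈ DOmega Ω \ chisPoles P E₀ Ω T) : -z ∈ DOmega Ω \ chisPoles P E₀ Ω T := by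
  refine ⟨by simpa [DOmega] using hz.1, ?_⟩
  rintro ⟨ω, h, h0, hω⟩
  refine hz.2 ⟨-ω, by rw [Complex.ofReal_neg, ← h, neg_neg], neg_ne_zero.2 h0, ?_⟩
  rwa [abs_neg]

lemma eq_of_inner_self_eq {A B : 𝓗' →L[ℂ] 𝓗'} (h : ∀ f, ⟪f, A f⟫_ℂ = ⟪f, B f⟫_ℂ) : A = B := by
  refine ContinuousLinearMap.coe_injective ((ext_inner_map _ _).1 fun f => ?_)
  change ⟪A f, f⟫_ℂ = ⟪B f, f⟫_ℂ
  rw [← inner_conj_symm, h, inner_conj_symm]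

variable [CompleteSpace 𝓗N] [CompleteSpace 𝓗']

lemma IsSymmetrizedDDRF.eq_adjoint_conj {P : SpectralData 𝓗N} {E₀ Ω : ℝ} {T : 𝓗N →L[ℂ] 𝓗'}
    {χs : ℂ → (𝓗' →L[ℂ] 𝓗')} (hχs : IsSymmetrizedDDRF P E₀ Ω T χs) {z : ℂ}
    (hz : z ∈ DOmega Ω \ chisPoles P E₀ Ω T) :
    χs z = ContinuousLinearMap.adjoint (χs ((starRingEnd ℂ) z)) := by
  refine eq_of_inner_self_eq fun f => ?_
  rw [ContinuousLinearMap.adjoint_inner_right, ← inner_conj_symm (χs _ f) f, (hχs z hz f).2,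
    (hχs _ (conj_mem_DOmega_diff_chisPoles hz) f).2, ← integral_conj]
  simp [Complex.conj_ofNat]

lemma IsSymmetrizedDDRF.eq_neg {P : SpectralData 𝓗N} {E₀ Ω : ℝ} {T : 𝓗N →L[ℂ] 𝓗'}
    {χs : ℂ → (𝓗' →L[ℂ] 𝓗')} (hχs : IsSymmetrizedDDRF P E₀ Ω T χs) {z : ℂ}
    (hz : z ∈ DOmega Ω \ chisPoles P E₀ Ω T) : χs z = χs (-z) := by
  refine eq_of_inner_self_eq fun f => ?_
  rw [(hχs z hz f).2, (hχs _ (neg_mem_DOmega_diff_chisPoles hz) f).2, neg_sq]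

lemma IsSymmetrizedDDRF.isSelfAdjoint {P : SpectralData 𝓗N} {E₀ Ω : ℝ} {T : 𝓗N →L[ℂ] 𝓗'}
    {χs : ℂ → (𝓗' →L[ℂ] 𝓗')} (hχs : IsSymmetrizedDDRF P E₀ Ω T χs) {ω : ℝ}
    (hω : (ω : ℂ) ∈ DOmega Ω \ chisPoles P E₀ Ω T) : IsSelfAdjoint (χs (ω : ℂ)) := by
  have h := hχs.eq_adjoint_conj hω
  rw [Complex.conj_ofReal] at h
  rw [ContinuousLinearMap.isSelfAdjoint_iff']
  exact h.symm

/-- Away from the excitations with energy below `|ω|`, the form of `χ̂_s(ω)` is nonpositive. -/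
lemma IsSymmetrizedDDRF.re_inner_nonpos {P : SpectralData 𝓗N} {E₀ Ω : ℝ} {T : 𝓗N →L[ℂ] 𝓗'}
    {χs : ℂ → (𝓗' →L[ℂ] 𝓗')} (hχs : IsSymmetrizedDDRF P E₀ Ω T χs)
    (hbot : P.proj (Set.Iio E₀) = 0) {ω : ℝ}
    (hω : (ω : ℂ) ∈ DOmega Ω \ chisPoles P E₀ Ω T) {f : 𝓗'}
    (hf : P.proj (Set.Ioo E₀ (E₀ + |ω|)) (T.adjoint f) = 0) :
    (⟪f, χs (ω : ℂ) f⟫_ℂ).re ≤ 0 := by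
  have hint : ∀ lam : ℝ, (2 * ((E₀ : ℂ) - lam)) / (((E₀ : ℂ) - lam) ^ 2 - (ω : ℂ) ^ 2)
      = ((2 * (E₀ - lam) / ((E₀ - lam) ^ 2 - ω ^ 2) : ℝ) : ℂ) := fun lam => by push_cast; rfl
  rw [(hχs _ hω f).2, integral_congr_ae (Filter.Eventually.of_forall hint), integral_complex_ofReal,
    Complex.ofReal_re]
  refine integral_nonpos_of_ae ?_
  have h1 : P.diag (T.adjoint f) (Set.Ioo E₀ (E₀ + |ω|)) = 0 :=
    (P.diag_eq_zero_iff measurableSet_Ioo _).2 hf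
  have h2 : P.diag (T.adjoint f) (Set.Iio E₀) = 0 :=
    (P.diag_eq_zero_iff measurableSet_Iio _).2 (by rw [hbot]; rfl)
  filter_upwards [compl_mem_ae_iff.2 h1, compl_mem_ae_iff.2 h2] with lam hl1 hl2
  simp only [Set.mem_compl_iff, Set.mem_Ioo, Set.mem_Iio, not_and, not_lt] at hl1 hl2
  rcases hl2.eq_or_lt with h | h
  · simp [h]
  · have h3 := hl1 h
    refine div_nonpos_of_nonpos_of_nonneg (by linarith) ?_
    rw [← sq_abs ω]
    nlinarith [abs_nonneg ω]

end Response

/-- Proposition 4.3: (i) `χ̂_s(z) = χ̂_s(z̄)* = χ̂_s(−z)` on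
`D_Ω ∖ P(χ̂_s)`; in particular `χ̂_s(ω)` is self-adjoint for real `ω`; and (ii) for real
`ω ∈ (−Ω,Ω) ∖ P(χ̂_s)`, the essential spectrum of `χ̂_s(ω)` is contained in `(−∞, 0]`. -/
theorem symmetrized_ddrf_symmetries_and_essential_spectrum
    {𝓗N 𝓗' : Type*} [NormedAddCommGroup 𝓗N] [InnerProductSpace ℂ 𝓗N] [CompleteSpace 𝓗N]
    [NormedAddCommGroup 𝓗'] [InnerProductSpace ℂ 𝓗'] [CompleteSpace 𝓗']
    (P : SpectralData 𝓗N) (E₀ : ℝ) (Ψ₀ : 𝓗N) (hgs : IsGroundState P E₀ Ψ₀)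
    (Ω : ℝ) (hness : P.essSpec.Nonempty) (hΩ : Ω = sInf P.essSpec - E₀) (hΩpos : 0 < Ω)
    (T : 𝓗N →L[ℂ] 𝓗')
    (χs : ℂ → (𝓗' →L[ℂ] 𝓗')) (hχs : IsSymmetrizedDDRF P E₀ Ω T χs) :
    -- (i) the symmetries (4.6)
    (∀ z ∈ DOmega Ω \ chisPoles P E₀ Ω T,
      χs z = ContinuousLinearMap.adjoint (χs ((starRingEnd ℂ) z)) ∧ χs z = χs (-z)) ∧
    (∀ ω : ℝ, (ω : ℂ) ∈ DOmega Ω \ chisPoles P E₀ Ω T → IsSelfAdjoint (χs (ω : ℂ))) ∧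
    -- (ii) the essential spectrum bound (4.7)
    (∀ ω : ℝ, (ω : ℂ) ∈ DOmega Ω \ chisPoles P E₀ Ω T →
      ∀ μ ∈ essSpecOp (χs (ω : ℂ)), μ.im = 0 ∧ μ.re ≤ 0) := by
  refine ⟨fun z hz => ⟨hχs.eq_adjoint_conj hz, hχs.eq_neg hz⟩, fun ω hω => hχs.isSelfAdjoint hω,
    fun ω hω μ hμ => ?_⟩
  have hωΩ : |ω| < Ω := by simpa [DOmega] using hω.1
  have hbdd : BddBelow P.essSpec := ⟨E₀, fun a ha => P.le_of_mem_essSpec hgs.bottom ha⟩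
  have hP : FiniteRankOp (P.proj (Set.Ioo E₀ (E₀ + |ω|))) :=
    P.finiteRankOp_proj_of_subset_Icc measurableSet_Ioo Set.Ioo_subset_Icc_self fun x hx hxe => by
      have h1 := csInf_le hbdd hxe
      have h2 := hx.2
      linarith
  have hPT : FiniteRankOp (P.proj (Set.Ioo E₀ (E₀ + |ω|)) ∘L T.adjoint) := by
    unfold FiniteRankOp at *
    exact Submodule.finiteDimensional_of_le (LinearMap.range_comp_le_range _ _)
  exact essSpecOp_nonpos_of_finiteRankOp (hχs.isSelfAdjoint hω) hPT
    (fun f hf => hχs.re_inner_nonpos hgs.bottom hω hf) hμ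

end
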